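/- Let M be a meet-semilattice, k a natural number, and R : M → (Fin k → M) → M a function satisfying R (x ⊓ y) (fun i => p i ⊓ q i) = R x p ⊓ R y q for all x, y ∈ M and p, q : Fin k → M. Let c, d ∈ M, p, q : Fin k → M, and g₁, g₂, g₃, g₄ ∈ M with g₁ > g₂, g₂ ≥ g₃, and g₃ > g₄. If ((R c p = g₁ and R d p = g₂) or (R c p = g₂ and R d p = g₁)) and ((R c q = g₃ and R d q = g₄) or (R c q = g₄ and R d q = g₃)), then a contradiction follows (False). -/

import Mathlib

/-- key step of Theorem 4.3: in a descending Mal'cev chain, no two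
nontrivial links can arise from the same ⊓-compatible operation. -/
theorem stmt_14 {M : Type*} [SemilatticeInf M] {k : ℕ}
    (R : M → (Fin k → M) → M)
    (hR : ∀ (x y : M) (p q : Fin k → M),
      R (x ⊓ y) (fun i => p i ⊓ q i) = R x p ⊓ R y q)
    (c d : M) (p q : Fin k → M) (g₁ g₂ g₃ g₄ : M)
    (h12 : g₁ > g₂) (h23 : g₂ ≥ g₃) (h34 : g₃ > g₄)
    (hp : (R c p = g₁ ∧ R d p = g₂) ∨ (R c p = g₂ ∧ R d p = g₁))
    (hq : (R c q = g₃ ∧ R d q = g₄) ∨ (R c q = g₄ ∧ R d q = g₃)) :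
    False := by
  have h1 := hR c d p q
  have h2 := hR d c p q
  rw [inf_comm d c, h1] at h2
  have h13 : g₃ ≤ g₁ := h23.trans h12.le
  have h14 : g₄ ≤ g₁ := h34.le.trans h13
  have h24 : g₄ ≤ g₂ := h34.le.trans h23
  have h23' : g₃ ≤ g₂ := h23
  rcases hp with ⟨a, b⟩ | ⟨a, b⟩ <;> rcases hq with ⟨e, f⟩ | ⟨e, f⟩ <;>
    rw [a, b, e, f] at h2 <;>
    simp only [inf_eq_right.2 h13, inf_eq_right.2 h14, inf_eq_right.2 h24,
      inf_eq_right.2 h23'] at h2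
  · exact h34.ne h2
  · exact h34.ne h2.symm
  · exact h34.ne h2
  · exact h34.ne h2.symm
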